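/- Let (X, μ) be an ergodic probability-measure-preserving ℤ^r-space and B a measurable set with μ(B) > 0. For every ε > 0 there exist an integer n, a constant c > 0, and a probability measure ν on X that is invariant and ergodic for the restricted action of the finite-index subgroup Λ(n) := n!·ℤ^r, such that: (i) ν(B) > μ(B)/3; (ii) σ_{ν,B}(Rat Λ(n) \ {0}) < ε, where σ_{ν,B} is the spectral measure of B with respect to ν and the Λ(n)-action; and (iii) μ(⋂_{v∈F} v.B) ≥ c·ν(⋂_{v∈F} v.B) for every finite subset F ⊆ Λ(n). -/

import Mathlib

open MeasureTheory

/-- The pairing `⟨ξ, v⟩ ∈ ℂ` between a character `ξ ∈ 𝕋^r` and `v ∈ ℤ^r`; identifying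
`Λ(n) = n!·ℤ^r` with `ℤ^r` via the basis `n!·e_1, …, n!·e_r`, this is also the pairing
between the dual group of `Λ(n)` and `Λ(n)`. -/
noncomputable def charPair {r : ℕ} (ξ : Fin r → AddCircle (1 : ℝ)) (v : Fin r → ℤ) : ℂ :=
  ∏ i, (AddCircle.toCircle ((v i) • ξ i) : ℂ)

/-- The rational spectrum: characters whose kernel has finite index, equivalently the
torsion points of `𝕋^r`. -/
def ratSpectrum (r : ℕ) : Set (Fin r → AddCircle (1 : ℝ)) :=
  {ξ | ∀ i, IsOfFinAddOrder (ξ i)}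

open UnitAddTorus Filter Topology ComplexConjugate

/-- The normalised Haar measure on the torus. -/
noncomputable def torusHaar (d : Type*) [Fintype d] : Measure (UnitAddTorus d) :=
  Measure.pi fun _ => AddCircle.haarAddCircle

instance {d : Type*} [Fintype d] : IsProbabilityMeasure (torusHaar d) := by
  unfold torusHaar; infer_instance

lemma integral_fourier_haarAddCircle (n : ℤ) :
    ∫ x : UnitAddCircle, fourier n x ∂AddCircle.haarAddCircle = if n = 0 then 1 else 0 := by
  split_ifs with h
  · simp [h]
  · exact integral_eq_zero_of_add_right_eq_neg (fourier_add_half_inv_index h one_pos)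

lemma integral_mFourier_torusHaar {d : Type*} [Fintype d] [DecidableEq d] (n : d → ℤ) :
    ∫ x, mFourier n x ∂torusHaar d = if n = 0 then 1 else 0 := by
  simp only [mFourier, ContinuousMap.coe_mk, torusHaar]
  rw [integral_fintype_prod_eq_prod]
  simp only [integral_fourier_haarAddCircle]
  split_ifs with h
  · simp [h]
  · obtain ⟨i, hi⟩ := Function.ne_iff.mp h
    exact Finset.prod_eq_zero (Finset.mem_univ i) (by simpa using hi)

lemma integrable_mFourier {d : Type*} [Fintype d] (n : d → ℤ) (σ : Measure (UnitAddTorus d))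
    [IsFiniteMeasure σ] : Integrable (fun x => mFourier n x) σ :=
  (BoundedContinuousFunction.mkOfCompact (mFourier n)).integrable σ

open ComplexOrder in
/-- Positive definiteness of a function on the group `d → ℤ`. -/
def PosDefFun {d : Type*} (φ : (d → ℤ) → ℂ) : Prop :=
  ∀ (s : Finset (d → ℤ)) (a : (d → ℤ) → ℂ),
    0 ≤ ∑ u ∈ s, ∑ v ∈ s, a u * conj (a v) * φ (u - v)

open ComplexOrder in
lemma exists_measure_integral_mFourier_eq_count {d : Type*} [Fintype d] [DecidableEq d]
    {φ : (d → ℤ) → ℂ} (hφ : PosDefFun φ) (s : Finset (d → ℤ)) (hs : s.Nonempty) :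
    ∃ σ : FiniteMeasure (UnitAddTorus d), ∀ w : d → ℤ,
      ∫ x, mFourier w x ∂(σ : Measure (UnitAddTorus d)) =
        ((s.filter fun u => u - w ∈ s).card / s.card : ℝ) * φ w := by
  have hc : (s.card : ℂ) ≠ 0 := by simpa using hs.ne_empty
  let P : UnitAddTorus d → ℂ := fun x =>
    ∑ u ∈ s, ∑ v ∈ s, ((s.card : ℂ)⁻¹ * φ (u - v)) * mFourier (v - u) x
  have hPc : Continuous P := by fun_prop
  have hP (x) : 0 ≤ P x := by
    have h := mul_nonneg (inv_nonneg.2 (Nat.cast_nonneg s.card : (0 : ℂ) ≤ s.card))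
      (hφ s fun u => mFourier (-u) x)
    refine h.trans_eq ?_
    simp only [P, Finset.mul_sum]
    refine Finset.sum_congr rfl fun u _ => Finset.sum_congr rfl fun v _ => ?_
    rw [← mFourier_neg, neg_neg, sub_eq_add_neg v u, mFourier_add]
    ring
  have hPre (x) : (((P x).re.toNNReal : ℝ) : ℂ) = P x := by
    rw [Real.coe_toNNReal _ (Complex.nonneg_iff.1 (hP x)).1]
    exact Complex.ext rfl (by simpa using (Complex.nonneg_iff.1 (hP x)).2)
  have hm : Continuous fun x => (P x).re.toNNReal := by fun_prop
  let σ := (torusHaar d).withDensity fun x => ((P x).re.toNNReal : ENNReal)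
  have : IsFiniteMeasure σ := by
    refine isFiniteMeasure_withDensity ?_
    obtain ⟨C, hC⟩ := (isCompact_range hm).bddAbove
    refine ((lintegral_mono (g := fun _ => (C : ENNReal)) fun x =>
      ENNReal.coe_le_coe.2 (hC ⟨x, rfl⟩)).trans_lt ?_).ne
    simp
  refine ⟨⟨σ, this⟩, fun w => ?_⟩
  change ∫ x, mFourier w x ∂σ = _
  rw [integral_withDensity_eq_integral_smul hm.measurable]
  simp only [NNReal.smul_def, Complex.real_smul, hPre]
  have hexp (x) : P x * mFourier w x = ∑ u ∈ s, ∑ v ∈ s,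
      ((s.card : ℂ)⁻¹ * φ (u - v)) * mFourier (v - u + w) x := by
    simp only [P, Finset.sum_mul, mFourier_add, mul_assoc]
  simp only [hexp]
  rw [integral_finsetSum _ fun u _ => integrable_finsetSum _ fun v _ =>
    (integrable_mFourier _ _).const_mul _]
  have hterm (u : d → ℤ) : ∫ x, ∑ v ∈ s, ((s.card : ℂ)⁻¹ * φ (u - v)) * mFourier (v - u + w) x
      ∂torusHaar d = if u - w ∈ s then (s.card : ℂ)⁻¹ * φ w else 0 := by
    rw [integral_finsetSum _ fun v _ => (integrable_mFourier _ _).const_mul _]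
    simp only [integral_const_mul, integral_mFourier_torusHaar]
    rw [← Finset.sum_ite_eq s (u - w) fun _ => (s.card : ℂ)⁻¹ * φ w]
    refine Finset.sum_congr rfl fun v _ => ?_
    have : v - u + w = 0 ↔ u - w = v := by
      rw [sub_add, sub_eq_zero, eq_comm]
    simp only [this]
    split_ifs with h
    · rw [← h]; simp
    · simp
  simp only [hterm]
  rw [← Finset.sum_filter, Finset.sum_const, nsmul_eq_mul]
  push_cast
  ring

/-- The cube `[0, M]^d`. -/
noncomputable def intCube (d : Type*) [Fintype d] [DecidableEq d] (M : ℕ) : Finset (d → ℤ) :=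
  Fintype.piFinset fun _ => Finset.Icc 0 (M : ℤ)

lemma intCube_nonempty (d : Type*) [Fintype d] [DecidableEq d] (M : ℕ) :
    (intCube d M).Nonempty :=
  ⟨0, by simp [intCube]⟩

lemma tendsto_card_intCube_filter {d : Type*} [Fintype d] [DecidableEq d] (w : d → ℤ) :
    Tendsto (fun M : ℕ => (((intCube d M).filter fun u => u - w ∈ intCube d M).card /
      (intCube d M).card : ℝ)) atTop (𝓝 1) := by
  have hfilter (M : ℕ) : (intCube d M).filter (fun u => u - w ∈ intCube d M) =
      Fintype.piFinset fun i => Finset.Icc (max 0 (w i)) (min (M : ℤ) (M + w i)) := by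
    ext u
    simp only [intCube, Finset.mem_filter, Fintype.mem_piFinset, Finset.mem_Icc, Pi.sub_apply,
      ← forall_and]
    refine forall_congr' fun i => ?_
    grind
  have hratio (M : ℕ) : (((intCube d M).filter fun u => u - w ∈ intCube d M).card /
      (intCube d M).card : ℝ) = ∏ i, (((M : ℤ) + 1 - |w i|).toNat : ℝ) / ((M : ℝ) + 1) := by
    rw [hfilter, intCube, Fintype.card_piFinset, Fintype.card_piFinset, Finset.prod_div_distrib]
    push_cast
    congr 1
    · refine Finset.prod_congr rfl fun i _ => ?_
      rw [Int.card_Icc]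
      congr 2
      grind
    · refine Finset.prod_congr rfl fun i _ => ?_
      rw [Int.card_Icc, sub_zero, show ((M : ℤ) + 1).toNat = M + 1 by lia]
      norm_cast
  simp only [hratio]
  have hone : (1 : ℝ) = ∏ _i : d, (1 : ℝ) := by simp
  refine (tendsto_finsetProd (a := fun _ => (1 : ℝ)) Finset.univ fun i _ => ?_).trans
    (congrArg 𝓝 hone.symm).le
  have h : Tendsto (fun M : ℕ => 1 - (|w i| : ℝ) * (1 / ((M : ℝ) + 1))) atTop (𝓝 1) := by
    simpa using (tendsto_one_div_add_atTop_nhds_zero_nat (𝕜 := ℝ)).const_mul (|w i| : ℝ)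
      |>.const_sub 1
  refine h.congr' ?_
  filter_upwards [eventually_ge_atTop (|w i|).toNat] with M hM
  have h1 : (((M : ℤ) + 1 - |w i|).toNat : ℤ) = (M : ℤ) + 1 - |w i| := by grind
  have h2 : (((M : ℤ) + 1 - |w i|).toNat : ℝ) = (M : ℝ) + 1 - |(w i : ℝ)| := by
    exact_mod_cast congrArg (Int.cast : ℤ → ℝ) h1
  rw [h2]
  have : (M : ℝ) + 1 ≠ 0 := by positivity
  field_simp

/-- **Herglotz–Bochner theorem** for `ℤ^d`. -/
theorem PosDefFun.exists_measure {d : Type*} [Fintype d] [DecidableEq d]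
    {φ : (d → ℤ) → ℂ} (hφ : PosDefFun φ) :
    ∃ σ : Measure (UnitAddTorus d), IsFiniteMeasure σ ∧ ∀ w, ∫ x, mFourier w x ∂σ = φ w := by
  choose σ hσ using fun M =>
    exists_measure_integral_mFourier_eq_count hφ (intCube d M) (intCube_nonempty d M)
  have hmass (M) : σ M ∈ {ν : FiniteMeasure (UnitAddTorus d) | ν.mass ≤ ‖φ 0‖₊} := by
    have h := hσ M 0
    have hc : ((intCube d M).card : ℝ) ≠ 0 := by simpa using (intCube_nonempty d M).ne_empty
    simp only [mFourier_zero, ContinuousMap.one_apply, integral_const, sub_zero,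
      Finset.filter_mem_eq_inter, Finset.inter_self, div_self hc] at h
    change (σ M).mass ≤ _
    rw [Complex.ofReal_one, one_mul] at h
    rw [← NNReal.coe_le_coe, coe_nnnorm, ← h, norm_smul, norm_one, mul_one]
    exact le_abs_self _
  obtain ⟨ν, -, hν⟩ := (isCompact_setOfPred_finiteMeasure_le_of_compactSpace _
    ‖φ 0‖₊).ultrafilter_le_nhds ((hyperfilter ℕ).map σ)
      (le_principal_iff.2 (Filter.mem_map.2 (Filter.univ_mem' hmass)))
  refine ⟨ν, inferInstance, fun w => ?_⟩
  have h1 := (FiniteMeasure.tendsto_iff_forall_integral_rclike_tendsto ℂ).1 hν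
    (BoundedContinuousFunction.mkOfCompact (mFourier w))
  refine tendsto_nhds_unique h1 ?_
  simp only [BoundedContinuousFunction.mkOfCompact_apply, hσ]
  have h2 := ((Complex.continuous_ofReal.tendsto 1).comp
    ((tendsto_card_intCube_filter w).mono_left Nat.hyperfilter_le_atTop)).mul_const (φ w)
  simpa using h2

/-- Finite measures on the torus are determined by their Fourier coefficients. -/
theorem measure_ext_of_integral_mFourier {d : Type*} [Fintype d]
    {σ τ : Measure (UnitAddTorus d)} [IsFiniteMeasure σ] [IsFiniteMeasure τ]
    (h : ∀ w, ∫ x, mFourier w x ∂σ = ∫ x, mFourier w x ∂τ) : σ = τ := by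
  let e : BoundedContinuousFunction (UnitAddTorus d) ℂ →⋆ₐ[ℂ] C(UnitAddTorus d, ℂ) :=
    BoundedContinuousFunction.toContinuousMapStarₐ ℂ
  refine ext_of_forall_mem_subalgebra_integral_eq_of_polish (𝕜 := ℂ)
    (A := (mFourierSubalgebra d).comap e) ?_ ?_
  · intro x y hxy
    obtain ⟨_, ⟨f, hf, rfl⟩, hne⟩ := mFourierSubalgebra_separatesPoints hxy
    exact ⟨f, ⟨f, ⟨BoundedContinuousFunction.mkOfCompact f, hf, rfl⟩, rfl⟩, hne⟩
  · intro g hg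
    have hg' : e g ∈ (mFourierSubalgebra d).toSubalgebra.toSubmodule := hg
    rw [mFourierSubalgebra_coe] at hg'
    change ∫ x, (e g) x ∂σ = ∫ x, (e g) x ∂τ
    have hint (f : C(UnitAddTorus d, ℂ)) (ρ : Measure (UnitAddTorus d)) [IsFiniteMeasure ρ] :
        Integrable f ρ := (BoundedContinuousFunction.mkOfCompact f).integrable ρ
    generalize e g = f at hg'
    induction hg' using Submodule.span_induction with
    | mem f hf => obtain ⟨w, rfl⟩ := hf; exact h w
    | zero => simp
    | add f₁ f₂ _ _ h₁ h₂ =>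
      simp only [ContinuousMap.add_apply]
      rw [integral_add (hint _ _) (hint _ _), integral_add (hint _ _) (hint _ _), h₁, h₂]
    | smul c f _ hf =>
      simp only [ContinuousMap.smul_apply, integral_smul, hf]

/-- A measure-preserving action of `d → ℤ`, given by its family of maps. -/
structure IsMPAction {d X : Type*} [MeasurableSpace X] (μ : Measure X)
    (S : (d → ℤ) → X → X) : Prop where
  mp : ∀ v, MeasurePreserving (S v) μ μ
  zero : ∀ x, S 0 x = x
  add : ∀ v w x, S (v + w) x = S v (S w x)

namespace IsMPAction

variable {d X : Type*} [MeasurableSpace X] {μ : Measure X} {S : (d → ℤ) → X → X}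

lemma smul (hS : IsMPAction μ S) (N : ℤ) : IsMPAction μ fun w => S (N • w) where
  mp v := hS.mp _
  zero x := by simp [hS.zero]
  add v w x := by simp [smul_add, hS.add]

lemma image_eq_preimage (hS : IsMPAction μ S) (v : d → ℤ) (C : Set X) :
    S v '' C = S (-v) ⁻¹' C :=
  congrFun (Set.image_eq_preimage_of_inverse (f := S v) (g := S (-v))
    (fun x => by rw [← hS.add, neg_add_cancel, hS.zero])
    (fun x => by rw [← hS.add, add_neg_cancel, hS.zero])) C

lemma measurableSet_image (hS : IsMPAction μ S) (v : d → ℤ) {C : Set X} (hC : MeasurableSet C) :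
    MeasurableSet (S v '' C) :=
  hS.image_eq_preimage v C ▸ (hS.mp _).measurable hC

lemma posDefFun [IsFiniteMeasure μ] (hS : IsMPAction μ S) {C : Set X} (hC : MeasurableSet C) :
    PosDefFun fun w => ((μ (C ∩ S w '' C)).toReal : ℂ) := by
  intro s a
  let f (u : d → ℤ) : X → ℂ := (S (-u) ⁻¹' C).indicator 1
  have hff (u v : d → ℤ) : (fun x => f u x * conj (f v x)) =
      (S (-v) ⁻¹' (C ∩ S (u - v) '' C)).indicator 1 := by
    ext x
    have : S (-(u - v)) (S (-v) x) = S (-u) x := by rw [← hS.add]; congr 1; abel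
    rw [hS.image_eq_preimage]
    by_cases h1 : S (-u) x ∈ C <;> by_cases h2 : S (-v) x ∈ C <;>
      simp [-neg_sub, f, Set.indicator, h1, h2, this]
  have hmC (u v : d → ℤ) : MeasurableSet (S (-v) ⁻¹' (C ∩ S (u - v) '' C)) :=
    (hS.mp _).measurable (hC.inter (hS.measurableSet_image _ hC))
  have hint (u v : d → ℤ) : Integrable (fun x => f u x * conj (f v x)) μ := by
    rw [hff]
    exact (integrable_const (1 : ℂ)).indicator (hmC u v)
  have hval (u v : d → ℤ) : ((μ (C ∩ S (u - v) '' C)).toReal : ℂ) =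
      ∫ x, f u x * conj (f v x) ∂μ := by
    rw [hff, integral_indicator (hmC u v), Pi.one_def, setIntegral_const, Measure.real,
      (hS.mp _).measure_preimage (hC.inter (hS.measurableSet_image _ hC)).nullMeasurableSet]
    simp
  have hsum : ∑ u ∈ s, ∑ v ∈ s, a u * conj (a v) * ((μ (C ∩ S (u - v) '' C)).toReal : ℂ) =
      ∫ x, ((‖∑ u ∈ s, a u * f u x‖ ^ 2 : ℝ) : ℂ) ∂μ := by
    have hsq (x : X) : ((‖∑ u ∈ s, a u * f u x‖ ^ 2 : ℝ) : ℂ) =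
        ∑ u ∈ s, ∑ v ∈ s, a u * conj (a v) * (f u x * conj (f v x)) := by
      rw [Complex.ofReal_pow, ← Complex.mul_conj', map_sum, Finset.sum_mul_sum]
      simp only [map_mul]
      refine Finset.sum_congr rfl fun u _ => Finset.sum_congr rfl fun v _ => by ring
    simp only [hsq, hval]
    rw [integral_finsetSum _ fun u _ => integrable_finsetSum _ fun v _ => (hint u v).const_mul _]
    refine Finset.sum_congr rfl fun u _ => ?_
    rw [integral_finsetSum _ fun v _ => (hint u v).const_mul _]
    simp only [integral_const_mul]
  rw [hsum, integral_complex_ofReal]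
  exact_mod_cast integral_nonneg fun x => by positivity

lemma image_inter_of_preimage_eq (hS : IsMPAction μ S) {A : Set X} (hA : ∀ w, S w ⁻¹' A = A)
    (B : Set X) (w : d → ℤ) : S w '' (A ∩ B) = A ∩ S w '' B := by
  rw [hS.image_eq_preimage, hS.image_eq_preimage, Set.preimage_inter, hA]

variable [Fintype d] [DecidableEq d]

/-- In an ergodic action, sets invariant under `N·ℤ^d` of positive measure have measure bounded
below. -/
lemma one_le_card_mul_measure_of_invariant (hS : IsMPAction μ S)
    (herg : ∀ A : Set X, MeasurableSet A → (∀ v, S v ⁻¹' A = A) → μ A = 0 ∨ μ A = 1)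
    {N : ℕ} (hN : 0 < N) {A : Set X} (mA : MeasurableSet A)
    (hA : ∀ w, S ((N : ℤ) • w) ⁻¹' A = A) (hpos : 0 < μ A) :
    1 ≤ ((intCube d N).card : ENNReal) * μ A := by
  have hU : (⋃ v, S v ⁻¹' A) = ⋃ v ∈ intCube d N, S v ⁻¹' A := by
    refine Set.Subset.antisymm (Set.iUnion_subset fun v => ?_)
      (Set.iUnion₂_subset fun v _ => Set.subset_iUnion (fun v => S v ⁻¹' A) v)
    have hv : v = (N : ℤ) • (fun i => v i / N) + fun i => v i % N := by
      ext i
      simp [Int.mul_ediv_add_emod]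
    have hv' : S v ⁻¹' A = S (fun i => v i % N) ⁻¹' A := by
      conv_rhs => rw [← hA fun i => v i / N]
      ext x
      simp only [Set.mem_preimage, ← hS.add, ← hv]
    rw [hv']
    refine Set.subset_biUnion_of_mem (u := fun v => S v ⁻¹' A) ?_
    refine Finset.mem_coe.2 (Fintype.mem_piFinset.2 fun i => Finset.mem_Icc.2 ?_)
    exact ⟨Int.emod_nonneg _ (by lia), (Int.emod_lt_of_pos _ (by lia)).le⟩
  have hone : μ (⋃ v, S v ⁻¹' A) = 1 := by
    refine (herg _ (MeasurableSet.iUnion fun v => (hS.mp v).measurable mA) fun u => ?_).resolve_left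
      (hpos.trans_le (measure_mono ?_)).ne'
    · simp only [Set.preimage_iUnion, ← Set.preimage_comp]
      rw [← (Equiv.addRight u).surjective.iUnion_comp fun v => S v ⁻¹' A]
      refine Set.iUnion_congr fun v => ?_
      ext x
      simp [hS.add]
    · refine Set.subset_iUnion_of_subset 0 fun x hx => ?_
      simpa [hS.zero] using hx
  calc 1 = μ (⋃ v ∈ intCube d N, S v ⁻¹' A) := by rw [← hU, hone]
    _ ≤ ∑ v ∈ intCube d N, μ (S v ⁻¹' A) := measure_biUnion_finset_le _ _
    _ = (intCube d N).card * μ A := by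
      simp [(hS.mp _).measure_preimage mA.nullMeasurableSet]

variable [IsFiniteMeasure μ]

/-- The spectral measure of a measurable set. -/
noncomputable def spectralMeasure (hS : IsMPAction μ S) {C : Set X} (hC : MeasurableSet C) :
    Measure (UnitAddTorus d) :=
  (hS.posDefFun hC).exists_measure.choose

instance (hS : IsMPAction μ S) {C : Set X} (hC : MeasurableSet C) :
    IsFiniteMeasure (hS.spectralMeasure hC) :=
  (hS.posDefFun hC).exists_measure.choose_spec.1

lemma integral_spectralMeasure (hS : IsMPAction μ S) {C : Set X} (hC : MeasurableSet C)
    (w : d → ℤ) :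
    ∫ x, mFourier w x ∂hS.spectralMeasure hC = ((μ (C ∩ S w '' C)).toReal : ℂ) :=
  (hS.posDefFun hC).exists_measure.choose_spec.2 w

lemma spectralMeasure_smul (hS : IsMPAction μ S) {C : Set X} (hC : MeasurableSet C) (N : ℤ) :
    (hS.smul N).spectralMeasure hC = (hS.spectralMeasure hC).map fun ξ => N • ξ := by
  have hm : Measurable fun ξ : UnitAddTorus d => N • ξ :=
    (continuous_zsmul N).measurable
  refine measure_ext_of_integral_mFourier fun w => ?_
  rw [integral_spectralMeasure, integral_map hm.aemeasurable
    (mFourier w).continuous.aestronglyMeasurable, ← hS.integral_spectralMeasure hC (N • w)]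
  congr 1
  ext ξ
  simp only [mFourier, ContinuousMap.coe_mk, fourier_apply, Pi.smul_apply, smul_eq_mul, mul_comm N,
    mul_smul]

/-- The spectral measure is additive along a splitting into invariant sets. -/
lemma spectralMeasure_inter_add_diff (hS : IsMPAction μ S) {A D B : Set X}
    (hA : ∀ w, S w ⁻¹' A = A) (hD : ∀ w, S w ⁻¹' D = D)
    (mA : MeasurableSet A) (mD : MeasurableSet D) (mB : MeasurableSet B) :
    hS.spectralMeasure (mA.inter mB) =
      hS.spectralMeasure ((mA.inter mD).inter mB) + hS.spectralMeasure ((mA.diff mD).inter mB) := by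
  have hAD (w : d → ℤ) : S w ⁻¹' (A ∩ D) = A ∩ D := by rw [Set.preimage_inter, hA, hD]
  have hAD' (w : d → ℤ) : S w ⁻¹' (A \ D) = A \ D := by rw [Set.preimage_sdiff, hA, hD]
  refine measure_ext_of_integral_mFourier fun w => ?_
  rw [integral_add_measure (integrable_mFourier _ _) (integrable_mFourier _ _)]
  simp only [integral_spectralMeasure]
  rw [hS.image_inter_of_preimage_eq hA, hS.image_inter_of_preimage_eq hAD,
    hS.image_inter_of_preimage_eq hAD', ← Complex.ofReal_add]
  congr 1
  have := measureReal_inter_add_sdiff (μ := μ) (s := A ∩ B ∩ (A ∩ S w '' B)) mD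
  rw [Measure.real, Measure.real, Measure.real] at this
  rw [← this]
  congr 3 <;> · ext x; simp only [Set.mem_inter_iff, Set.mem_sdiff]; tauto

end IsMPAction

lemma mem_ratSpectrum_iff {r : ℕ} {ξ : Fin r → AddCircle (1 : ℝ)} :
    ξ ∈ ratSpectrum r ↔ ∃ n : ℕ, (n.factorial : ℤ) • ξ = 0 := by
  constructor
  · intro h
    refine ⟨∑ i, addOrderOf (ξ i), funext fun i => ?_⟩
    have hd : addOrderOf (ξ i) ∣ (∑ i, addOrderOf (ξ i)).factorial :=
      Nat.dvd_factorial (h i).addOrderOf_pos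
        (Finset.single_le_sum (f := fun i => addOrderOf (ξ i)) (fun _ _ => Nat.zero_le _)
          (Finset.mem_univ i))
    rw [Pi.smul_apply, natCast_zsmul]
    exact addOrderOf_dvd_iff_nsmul_eq_zero.1 hd
  · rintro ⟨n, hn⟩ i
    refine isOfFinAddOrder_iff_nsmul_eq_zero.2 ⟨n.factorial, n.factorial_pos, ?_⟩
    simpa using congrFun hn i

lemma measurableSet_zsmul_eq_zero {d : Type*} [Finite d] (N : ℤ) :
    MeasurableSet {ξ : UnitAddTorus d | N • ξ = 0} :=
  (isClosed_eq (continuous_zsmul N) continuous_const).measurableSet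

lemma measurableSet_ratSpectrum (r : ℕ) : MeasurableSet (ratSpectrum r) := by
  have : ratSpectrum r = ⋃ n : ℕ, {ξ : UnitAddTorus (Fin r) | (n.factorial : ℤ) • ξ = 0} := by
    ext ξ
    simp only [mem_ratSpectrum_iff, Set.mem_iUnion, Set.mem_ofPred_eq]
  exact this ▸ MeasurableSet.iUnion fun n => measurableSet_zsmul_eq_zero _

lemma zsmul_mem_ratSpectrum_iff {r : ℕ} {ξ : Fin r → AddCircle (1 : ℝ)} {N : ℕ} (hN : N ≠ 0) :
    (N : ℤ) • ξ ∈ ratSpectrum r ↔ ξ ∈ ratSpectrum r := by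
  refine forall_congr' fun i => ?_
  rw [Pi.smul_apply, natCast_zsmul, isOfFinAddOrder_nsmul]
  exact or_iff_left hN

/-- The nonzero rational spectrum. -/
def nonzeroRatSpectrum (r : ℕ) : Set (UnitAddTorus (Fin r)) :=
  {ξ | ξ ∈ ratSpectrum r ∧ ξ ≠ 0}

lemma measurableSet_nonzeroRatSpectrum (r : ℕ) : MeasurableSet (nonzeroRatSpectrum r) :=
  (measurableSet_ratSpectrum r).inter (measurableSet_singleton (0 : UnitAddTorus (Fin r))).compl

lemma tendsto_map_factorial_smul_nonzeroRatSpectrum {r : ℕ} (σ : Measure (UnitAddTorus (Fin r)))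
    [IsFiniteMeasure σ] :
    Tendsto (fun n : ℕ => (σ.map fun ξ => (n.factorial : ℤ) • ξ).real (nonzeroRatSpectrum r))
      atTop (𝓝 0) := by
  let E (n : ℕ) : Set (UnitAddTorus (Fin r)) :=
    {ξ | ξ ∈ ratSpectrum r ∧ (n.factorial : ℤ) • ξ ≠ 0}
  have hE (n : ℕ) : MeasurableSet (E n) :=
    (measurableSet_ratSpectrum r).inter (measurableSet_zsmul_eq_zero _).compl
  have hmap (n : ℕ) : (σ.map fun ξ => (n.factorial : ℤ) • ξ) (nonzeroRatSpectrum r) = σ (E n) := by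
    rw [Measure.map_apply (continuous_zsmul _).measurable (measurableSet_nonzeroRatSpectrum r)]
    congr 1
    ext ξ
    exact and_congr_left' (zsmul_mem_ratSpectrum_iff n.factorial_ne_zero)
  have hanti : Antitone E := by
    rintro m n hmn ξ ⟨h1, h2⟩
    refine ⟨h1, fun h => h2 ?_⟩
    obtain ⟨k, hk⟩ := Nat.factorial_dvd_factorial hmn
    rw [hk, Nat.cast_mul, mul_comm, mul_smul, h, smul_zero]
  have hempty : ⋂ n, E n = ∅ := by
    refine Set.eq_empty_of_forall_notMem fun ξ hξ => ?_
    rw [Set.mem_iInter] at hξ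
    obtain ⟨n, hn⟩ := mem_ratSpectrum_iff.1 (hξ 0).1
    exact (hξ n).2 hn
  have h := tendsto_measure_iInter_atTop (μ := σ) (fun n => (hE n).nullMeasurableSet) hanti
    ⟨0, measure_ne_top _ _⟩
  rw [hempty, measure_empty] at h
  simp only [Measure.real, hmap]
  exact (ENNReal.tendsto_toReal ENNReal.zero_ne_top).comp h

/-- Let `m` and `h` be additive on a family `P` of sets, with `h ≤ m` and every nonzero value of `m`
at least `δ`. If `h` is positive on some member of `P`, then it is positive on an atom of `m`. -/
lemma exists_atom_of_additive {X : Type*} {P : Set X → Prop} {m h : Set X → ℝ} {δ : ℝ}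
    (hδ : 0 < δ) (hm : ∀ A, P A → 0 < m A → δ ≤ m A) (hm0 : ∀ A, 0 ≤ m A)
    (hmono : ∀ A, P A → h A ≤ m A)
    (hP : ∀ A D, P A → P D → P (A ∩ D) ∧ P (A \ D))
    (hadd : ∀ A D, P A → P D → m A = m (A ∩ D) + m (A \ D) ∧ h A = h (A ∩ D) + h (A \ D))
    {A : Set X} (hA : P A) (hpos : 0 < h A) :
    ∃ A, P A ∧ 0 < h A ∧ ∀ D, P D → m (A ∩ D) = 0 ∨ m (A \ D) = 0 := by
  obtain ⟨k, hk⟩ := Archimedean.arch (m A) hδ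
  rw [nsmul_eq_mul] at hk
  induction k generalizing A with
  | zero => exact absurd (hpos.trans_le (hmono A hA)) (by simpa using hk)
  | succ k ih =>
    by_cases hatom : ∀ D, P D → m (A ∩ D) = 0 ∨ m (A \ D) = 0
    · exact ⟨A, hA, hpos, hatom⟩
    · push Not at hatom
      obtain ⟨D, hD, h1, h2⟩ := hatom
      obtain ⟨hP1, hP2⟩ := hP A D hA hD
      obtain ⟨hm', hh'⟩ := hadd A D hA hD
      have h1' := hm _ hP1 ((hm0 _).lt_of_ne' h1)
      have h2' := hm _ hP2 ((hm0 _).lt_of_ne' h2)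
      push_cast at hk
      rcases lt_or_ge 0 (h (A ∩ D)) with h3 | h3
      · exact ih hP1 h3 (by linarith)
      · exact ih hP2 (by linarith) (by linarith)

/-- Let `(X, μ)` be an ergodic p.m.p. `ℤ^r`-space and `μ(B) > 0`.  For every `ε > 0`
there are `n ∈ ℕ`, `c > 0` and a probability measure `ν` on `X`, invariant and ergodic
for the restricted action of `Λ(n) := n!·ℤ^r` (identified with `ℤ^r` via `w ↦ n!·w`),
such that (i) `ν(B) > μ(B)/3`; (ii) the spectral measure `σ_{ν,B}` of `B` with respect
to `ν` and the `Λ(n)`-action satisfies `σ_{ν,B}(Rat Λ(n) \ {0}) < ε`; and (iii)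
`μ(⋂_{v ∈ F} v.B) ≥ c·ν(⋂_{v ∈ F} v.B)` for every finite `F ⊆ Λ(n)`. -/
theorem exists_ergodic_component
    {r : ℕ} {X : Type*} [MeasurableSpace X] (μ : Measure X) [IsProbabilityMeasure μ]
    (T : (Fin r → ℤ) → X → X)
    (hmp : ∀ v, MeasurePreserving (T v) μ μ)
    (hzero : ∀ x, T 0 x = x)
    (hadd : ∀ v w x, T (v + w) x = T v (T w x))
    (herg : ∀ A : Set X, MeasurableSet A → (∀ v, T v ⁻¹' A = A) → μ A = 0 ∨ μ A = 1)
    (B : Set X) (hB : MeasurableSet B) (hBpos : 0 < μ B)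
    (ε : ℝ) (hε : 0 < ε) :
    ∃ (n : ℕ) (c : ℝ) (ν : Measure X), 0 < c ∧ IsProbabilityMeasure ν ∧
      (∀ w : Fin r → ℤ, MeasurePreserving (T ((Nat.factorial n : ℤ) • w)) ν ν) ∧
      (∀ A : Set X, MeasurableSet A →
        (∀ w : Fin r → ℤ, T ((Nat.factorial n : ℤ) • w) ⁻¹' A = A) → ν A = 0 ∨ ν A = 1) ∧
      (ν B).toReal > (μ B).toReal / 3 ∧
      (∃ σ : Measure (Fin r → AddCircle (1 : ℝ)), IsFiniteMeasure σ ∧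
        (∀ w : Fin r → ℤ,
          ((ν (B ∩ T ((Nat.factorial n : ℤ) • w) '' B)).toReal : ℂ) = ∫ ξ, charPair ξ w ∂σ) ∧
        (σ {ξ | ξ ∈ ratSpectrum r ∧ ξ ≠ 0}).toReal < ε) ∧
      (∀ F : Finset (Fin r → ℤ),
        ENNReal.ofReal c * ν (⋂ w ∈ F, T ((Nat.factorial n : ℤ) • w) '' B) ≤
          μ (⋂ w ∈ F, T ((Nat.factorial n : ℤ) • w) '' B)) := by
  classical
  have hT : IsMPAction μ T := ⟨hmp, hzero, hadd⟩
  have hBr : 0 < μ.real B := ENNReal.toReal_pos hBpos.ne' (measure_ne_top _ _)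
  obtain ⟨n, hn⟩ := ((tendsto_map_factorial_smul_nonzeroRatSpectrum
    (hT.spectralMeasure hB)).eventually_lt_const
      (show 0 < ε * μ.real B / 2 by positivity)).exists
  rw [← hT.spectralMeasure_smul hB] at hn
  have hS := hT.smul (n.factorial : ℤ)
  let P (A : Set X) : Prop :=
    MeasurableSet A ∧ ∀ w : Fin r → ℤ, T ((n.factorial : ℤ) • w) ⁻¹' A = A
  let s (A : Set X) : ℝ := if hA : MeasurableSet A then
    (hS.spectralMeasure (hA.inter hB)).real (nonzeroRatSpectrum r) else 0
  have hs {A : Set X} (hA : MeasurableSet A) :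
      s A = (hS.spectralMeasure (hA.inter hB)).real (nonzeroRatSpectrum r) := dif_pos hA
  have hs0 (A : Set X) : 0 ≤ s A := by
    simp only [s]; split_ifs <;> positivity
  let h (A : Set X) : ℝ := μ.real (A ∩ B) - μ.real A * μ.real B / 3 - s A / ε
  have hcard : 0 < ((intCube (Fin r) n.factorial).card : ℝ) := by
    exact_mod_cast (intCube_nonempty (Fin r) n.factorial).card_pos
  have huniv : 0 < h Set.univ := by
    have : s Set.univ < ε * μ.real B / 2 := by
      rw [hs MeasurableSet.univ]
      simpa only [Set.univ_inter] using hn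
    have h' : s Set.univ / ε < μ.real B / 2 := by
      rw [div_lt_iff₀ hε]; linarith
    simp only [h, Set.univ_inter, probReal_univ]
    linarith
  obtain ⟨A, ⟨mA, hA⟩, hpos, hatom⟩ := exists_atom_of_additive (P := P) (m := μ.real) (h := h)
    (δ := ((intCube (Fin r) n.factorial).card : ℝ)⁻¹) (inv_pos.2 hcard)
    (by
      rintro A ⟨mA, hA⟩ hpos
      have := hT.one_le_card_mul_measure_of_invariant herg n.factorial_pos mA hA
        (ENNReal.toReal_pos_iff.1 hpos).1
      have := ENNReal.toReal_mono (by finiteness) this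
      rw [ENNReal.toReal_mul, ENNReal.toReal_natCast, ENNReal.toReal_one] at this
      exact (inv_le_iff_one_le_mul₀' hcard).2 this)
    (fun _ => measureReal_nonneg)
    (by
      rintro A -
      have h1 : μ.real (A ∩ B) ≤ μ.real A := measureReal_mono Set.inter_subset_left
      have h2 : 0 ≤ μ.real A * μ.real B / 3 := by positivity
      have h3 : 0 ≤ s A / ε := div_nonneg (hs0 A) hε.le
      simp only [h]
      linarith)
    (by
      rintro A D ⟨mA, hA⟩ ⟨mD, hD⟩
      exact ⟨⟨mA.inter mD, fun w => by rw [Set.preimage_inter, hA, hD]⟩,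
        ⟨mA.diff mD, fun w => by rw [Set.preimage_sdiff, hA, hD]⟩⟩)
    (by
      rintro A D ⟨mA, hA⟩ ⟨mD, hD⟩
      have h1 : μ.real A = μ.real (A ∩ D) + μ.real (A \ D) :=
        (measureReal_inter_add_sdiff mD).symm
      have h2 : μ.real (A ∩ B) = μ.real (A ∩ D ∩ B) + μ.real ((A \ D) ∩ B) := by
        rw [← measureReal_inter_add_sdiff (s := A ∩ B) mD, Set.inter_right_comm,
          Set.inter_sdiff_right_comm]
      have h3 : s A = s (A ∩ D) + s (A \ D) := by
        rw [hs mA, hs (mA.inter mD), hs (mA.diff mD),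
          hS.spectralMeasure_inter_add_diff hA hD mA mD hB, measureReal_add_apply]
      refine ⟨h1, ?_⟩
      simp only [h]
      rw [h1, h2, h3]
      ring)
    ⟨MeasurableSet.univ, fun _ => Set.preimage_univ⟩ huniv
  have hAB : μ.real (A ∩ B) ≤ μ.real A := measureReal_mono Set.inter_subset_left
  have hA3 : 0 ≤ μ.real A * μ.real B / 3 := by positivity
  have hsA : 0 ≤ s A / ε := div_nonneg (hs0 A) hε.le
  simp only [h] at hpos
  have hAr : 0 < μ.real A := by linarith
  have hA0 : μ A ≠ 0 := (ENNReal.toReal_pos_iff.1 hAr).1.ne'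
  refine ⟨n, μ.real A, ProbabilityTheory.cond μ A, hAr,
    ProbabilityTheory.cond_isProbabilityMeasure hA0, fun w => ⟨(hS.mp w).measurable, ?_⟩,
    fun D mD hD => ?_, ?_, ⟨(μ A)⁻¹ • hS.spectralMeasure (mA.inter hB), ?_, fun w => ?_, ?_⟩,
    fun F => ?_⟩
  · ext D mD
    rw [Measure.map_apply (hS.mp w).measurable mD, ProbabilityTheory.cond_apply mA,
      ProbabilityTheory.cond_apply mA]
    nth_rw 2 [← hA w]
    rw [← Set.preimage_inter, (hS.mp w).measure_preimage (mA.inter mD).nullMeasurableSet]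
  · rcases hatom D ⟨mD, hD⟩ with h0 | h0
    · left
      rw [ProbabilityTheory.cond_apply mA, (measureReal_eq_zero_iff).1 h0, mul_zero]
    · right
      have : μ (A ∩ D) = μ A := by
        rw [← measure_inter_add_sdiff A mD, (measureReal_eq_zero_iff).1 h0, add_zero]
      rw [ProbabilityTheory.cond_apply mA, this, ENNReal.inv_mul_cancel hA0 (measure_ne_top _ _)]
  · rw [ProbabilityTheory.cond_apply mA, ENNReal.toReal_mul, ENNReal.toReal_inv]
    change μ.real B / 3 < (μ.real A)⁻¹ * μ.real (A ∩ B)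
    rw [inv_mul_eq_div, lt_div_iff₀ hAr]
    linarith
  · exact Measure.smul_finite _ (ENNReal.inv_ne_top.2 hA0)
  · have hchar (ξ : Fin r → AddCircle (1 : ℝ)) : charPair ξ w = mFourier w ξ := by
      simp [charPair, mFourier]
    simp only [hchar]
    rw [integral_smul_measure, hS.integral_spectralMeasure, hS.image_inter_of_preimage_eq hA,
      ProbabilityTheory.cond_apply mA, ENNReal.toReal_mul, Complex.ofReal_mul, Complex.real_smul]
    congr 4
    ext x
    simp only [Set.mem_inter_iff]
    tauto
  · change (((μ A)⁻¹ • hS.spectralMeasure (mA.inter hB)) (nonzeroRatSpectrum r)).toReal < ε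
    rw [Measure.smul_apply, smul_eq_mul, ENNReal.toReal_mul, ENNReal.toReal_inv]
    change (μ.real A)⁻¹ * (hS.spectralMeasure (mA.inter hB)).real (nonzeroRatSpectrum r) < ε
    rw [← hs mA, inv_mul_eq_div, div_lt_comm₀ hAr hε]
    linarith
  · rw [ProbabilityTheory.cond_apply mA, Measure.real, ENNReal.ofReal_toReal (measure_ne_top _ _),
      ← mul_assoc, ENNReal.mul_inv_cancel hA0 (measure_ne_top _ _), one_mul]
    exact measure_mono Set.inter_subset_right
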